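/- Let ω = (ω₁, ω₂) be irrational. If (k₁, k₂, k₃, k₄) ∈ R is nondegenerate, then k₁⁽¹⁾ ≠ k₂⁽¹⁾ and k₁⁽²⁾ ≠ k₂⁽²⁾; that is, the segment connecting the two parents k₁ and k₂ is not parallel to either coordinate axis. -/

import Mathlib

/-- `ω = (ω₁, ω₂)` is irrational: `ω₁m₁ + ω₂m₂ ≠ 0` for every nonzero `(m₁, m₂) ∈ ℤ²`. -/
def IsIrrationalPair (ω : ℝ × ℝ) : Prop :=
  ∀ m : ℤ × ℤ, m ≠ 0 → ω.1 * (m.1 : ℝ) + ω.2 * (m.2 : ℝ) ≠ 0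

/-- The frequency `λ_k = ω₁(k⁽¹⁾)² + ω₂(k⁽²⁾)²` for `k ∈ ℤ²`. -/
noncomputable def freq (ω : ℝ × ℝ) (k : ℤ × ℤ) : ℝ :=
  ω.1 * (k.1 : ℝ) ^ 2 + ω.2 * (k.2 : ℝ) ^ 2

/-- Membership in the resonance set `R`. -/
def InRes (ω : ℝ × ℝ) (k₁ k₂ k₃ k₄ : ℤ × ℤ) : Prop :=
  k₁ + k₂ = k₃ + k₄ ∧ freq ω k₁ + freq ω k₂ = freq ω k₃ + freq ω k₄

/-- A resonant 4-tuple is degenerate if `(k₃, k₄) = (k₁, k₂)` or `(k₃, k₄) = (k₂, k₁)`. -/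
def Degenerate (k₁ k₂ k₃ k₄ : ℤ × ℤ) : Prop :=
  (k₃ = k₁ ∧ k₄ = k₂) ∨ (k₃ = k₂ ∧ k₄ = k₁)

/-- Two integers are determined up to order by their sum and their sum of squares. -/
theorem eq_or_swap_of_add_eq_of_sq_add_sq_eq {a b c d : ℤ} (hs : a + b = c + d)
    (hq : a ^ 2 + b ^ 2 = c ^ 2 + d ^ 2) : (c = a ∧ d = b) ∨ (c = b ∧ d = a) := by
  obtain rfl : d = a + b - c := by linarith
  have h : (c - a) * (c - b) = 0 := by linarith
  rcases mul_eq_zero.mp h with h | h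
  · exact Or.inl ⟨by linarith, by linarith⟩
  · exact Or.inr ⟨by linarith, by linarith⟩

/-- For irrational `ω`, resonance in frequency decouples into the two coordinates. -/
theorem IsIrrationalPair.sq_add_sq_eq {ω : ℝ × ℝ} (hirr : IsIrrationalPair ω)
    {k₁ k₂ k₃ k₄ : ℤ × ℤ} (h : freq ω k₁ + freq ω k₂ = freq ω k₃ + freq ω k₄) :
    k₁.1 ^ 2 + k₂.1 ^ 2 = k₃.1 ^ 2 + k₄.1 ^ 2 ∧
      k₁.2 ^ 2 + k₂.2 ^ 2 = k₃.2 ^ 2 + k₄.2 ^ 2 := by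
  have hm : ((k₁.1 ^ 2 + k₂.1 ^ 2 - (k₃.1 ^ 2 + k₄.1 ^ 2),
      k₁.2 ^ 2 + k₂.2 ^ 2 - (k₃.2 ^ 2 + k₄.2 ^ 2)) : ℤ × ℤ) = 0 := by
    by_contra hne
    apply hirr _ hne
    unfold freq at h
    push_cast
    linarith
  exact ⟨sub_eq_zero.mp (congrArg Prod.fst hm), sub_eq_zero.mp (congrArg Prod.snd hm)⟩

/-- For irrational `ω`, in a nondegenerate resonant 4-tuple the segment connecting the
two parents `k₁` and `k₂` is not parallel to either coordinate axis:
`k₁⁽¹⁾ ≠ k₂⁽¹⁾` and `k₁⁽²⁾ ≠ k₂⁽²⁾`. -/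
theorem stmt_7 (ω : ℝ × ℝ) (hω1 : 0 < ω.1) (hω2 : 0 < ω.2)
    (hirr : IsIrrationalPair ω) (k₁ k₂ k₃ k₄ : ℤ × ℤ)
    (h : InRes ω k₁ k₂ k₃ k₄) (hnd : ¬ Degenerate k₁ k₂ k₃ k₄) :
    k₁.1 ≠ k₂.1 ∧ k₁.2 ≠ k₂.2 := by
  obtain ⟨hsum, hfreq⟩ := h
  obtain ⟨hq₁, hq₂⟩ := hirr.sq_add_sq_eq hfreq
  have h₁ := eq_or_swap_of_add_eq_of_sq_add_sq_eq (congrArg Prod.fst hsum) hq₁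
  have h₂ := eq_or_swap_of_add_eq_of_sq_add_sq_eq (congrArg Prod.snd hsum) hq₂
  simp only [Degenerate, Prod.ext_iff] at hnd
  constructor <;> intro heq <;> apply hnd <;> lia
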